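/- arXiv:1011.2254 — 2 statements merged into one kernel-verified Lean document; each statement's English description precedes it below -/
import Mathlib

section
/- Let Ω₁ and Ω₂ be disjoint finite sets of complex numbers with |Ω₁| = m and |Ω₂| = n. Then: (a) in ℂ[x₁,…,x_m], the identity det( h_{n−i+j}(X−Ω₂) )_{1≤i,j≤m} · ∏_{s∈Ω₁} ∏_{r∈Ω₂} (s − r) = det( h_{n−i+j}(Ω₁−Ω₂) )_{1≤i,j≤m} · ∏_{i=1}^{m} ∏_{r∈Ω₂} (x_i − r) holds; and (b) the complex number det( h_{n−i+j}(Ω₁−Ω₂) )_{1≤i,j≤m} is nonzero. -/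
open MvPolynomial

/-- The `k`-th complete homogeneous symmetric function of the elements of a finite multiset `A`
of complex numbers. -/
noncomputable def hMul (A : Multiset ℂ) (k : ℕ) : ℂ :=
  MvPolynomial.eval (fun i : Fin (Multiset.card A) => A.toList.getD i 0)
    (hsymm (Fin (Multiset.card A)) ℂ k)

/-- `h_k(A−B) := ∑_{j=0}^{k} (−1)^j e_j(B)·h_{k−j}(A) ∈ ℂ`, extended by `0` for negative
indices `k : ℤ`. -/
noncomputable def hMulSubZ (A B : Multiset ℂ) (k : ℤ) : ℂ :=
  if 0 ≤ k then
    ∑ j ∈ Finset.range (k.toNat + 1), (-1 : ℂ) ^ j * B.esymm j * hMul A (k.toNat - j)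
  else 0

/-- `h_k(X−B) := ∑_{j=0}^{k} (−1)^j e_j(B)·h_{k−j} ∈ ℂ[x₁,…,x_m]`, extended by `0` for
negative indices `k : ℤ`. -/
noncomputable def hXBZ (m : ℕ) (B : Multiset ℂ) (k : ℤ) : MvPolynomial (Fin m) ℂ :=
  if 0 ≤ k then
    ∑ j ∈ Finset.range (k.toNat + 1),
      ((-1 : ℂ) ^ j * B.esymm j) • hsymm (Fin m) ℂ (k.toNat - j)
  else 0

open scoped PowerSeries in
theorem coeff_eq_sum_of_mul_one_sub_eq {R : Type*} [CommRing R] {g E : R⟦X⟧} {x : R}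
    (h : g * (1 - PowerSeries.C x * PowerSeries.X) = E) (n : ℕ) :
    PowerSeries.coeff n g = ∑ j ∈ Finset.range (n + 1), PowerSeries.coeff j E * x ^ (n - j) := by
  induction n with
  | zero => simp [← h]
  | succ n ih =>
    have key : PowerSeries.coeff (n + 1) g =
        PowerSeries.coeff (n + 1) E + PowerSeries.coeff n g * x := by
      rw [← h, mul_sub, mul_one, ← mul_assoc, map_sub,
        PowerSeries.coeff_succ_mul_X, PowerSeries.coeff_mul_C]
      ring
    rw [Finset.sum_range_succ, key, ih, Finset.sum_mul, add_comm]
    simp only [Nat.sub_self, pow_zero, mul_one, add_left_inj]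
    refine Finset.sum_congr rfl fun j hj => ?_
    rw [mul_assoc, ← pow_succ]
    congr 2
    have := Finset.mem_range.1 hj
    omega

open scoped PowerSeries in
/-- If `f = E / ∏ (1 - xᵢ t)` with `deg E ≤ n`, the `m × m` Toeplitz determinant built on the
`n`-th coefficient of `f` is the product of the values `xᵢⁿ E(xᵢ⁻¹)`. -/
theorem det_toeplitz_coeff {R : Type*} [CommRing R] (n : ℕ) {E : R⟦X⟧}
    (hE : ∀ k, n < k → PowerSeries.coeff k E = 0) (m : ℕ) (x : Fin m → R) {f : R⟦X⟧}
    (h : f * ∏ i, (1 - PowerSeries.C (x i) * PowerSeries.X) = E) :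
    (Matrix.of fun i j : Fin m => PowerSeries.coeff (n + j) (PowerSeries.X ^ (i : ℕ) * f)).det
      = ∏ i, ∑ k ∈ Finset.range (n + 1), PowerSeries.coeff k E * x i ^ (n - k) := by
  induction m generalizing f with
  | zero => simp
  | succ m ih =>
    rw [Fin.prod_univ_succ] at h
    have h' : f * (1 - PowerSeries.C (x 0) * PowerSeries.X) *
        ∏ i : Fin m, (1 - PowerSeries.C (x i.succ) * PowerSeries.X) = E := by
      rw [mul_assoc, h]
    rw [Fin.prod_univ_succ, ← ih (fun i => x i.succ) h']
    set f' := f * (1 - PowerSeries.C (x 0) * PowerSeries.X) with hf'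
    let A : Polynomial R := ∏ i : Fin m, (1 - Polynomial.C (x i.succ) * Polynomial.X)
    have hA : (A : R⟦X⟧) =
        ∏ i : Fin m, (1 - PowerSeries.C (x i.succ) * PowerSeries.X) := by
      change Polynomial.coeToPowerSeries.ringHom A = _
      simp [A, map_prod]
    have hAdeg : A.natDegree < m + 1 := by
      refine Nat.lt_succ_of_le ((Polynomial.natDegree_prod_le _ _).trans ?_)
      refine (Finset.sum_le_card_nsmul _ _ 1 fun i _ => ?_).trans (by simp)
      compute_degree
    have hA0 : A.coeff 0 = 1 := by
      simp [A, Polynomial.coeff_zero_eq_eval_zero, Polynomial.eval_prod]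
    have hsum : ∀ g : R⟦X⟧, ∀ k,
        ∑ i : Fin (m + 1), A.coeff i * PowerSeries.coeff k (PowerSeries.X ^ (i : ℕ) * g) =
          PowerSeries.coeff k ((A : R⟦X⟧) * g) := by
      intro g k
      conv_rhs => rw [A.as_sum_range' _ hAdeg, ← Fin.sum_univ_eq_sum_range
        (fun i => Polynomial.monomial i (A.coeff i))]
      rw [← Polynomial.coeToPowerSeries.ringHom_apply, map_sum, Finset.sum_mul, map_sum]
      refine Finset.sum_congr rfl fun i _ => ?_
      rw [Polynomial.coeToPowerSeries.ringHom_apply, ← Polynomial.C_mul_X_pow_eq_monomial,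
        Polynomial.coe_mul, Polynomial.coe_pow, Polynomial.coe_C, Polynomial.coe_X, mul_assoc,
        PowerSeries.coeff_C_mul]
    let M : Matrix (Fin (m + 1)) (Fin (m + 1)) R := Matrix.of fun i j =>
      Fin.cases (PowerSeries.coeff n (PowerSeries.X ^ (i : ℕ) * f))
        (fun j : Fin m => PowerSeries.coeff (n + j + 1) (PowerSeries.X ^ (i : ℕ) * f')) j
    have hcol : (Matrix.of fun i j : Fin (m + 1) =>
        PowerSeries.coeff (n + j) (PowerSeries.X ^ (i : ℕ) * f)).det
        = M.det := by
      refine Matrix.det_eq_of_forall_col_eq_smul_add_pred (fun _ => x 0) (fun i => by simp [M])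
        fun i j => ?_
      have : PowerSeries.X ^ (i : ℕ) * f' = PowerSeries.X ^ (i : ℕ) * f -
          PowerSeries.C (x 0) * (PowerSeries.X ^ (i : ℕ) * f) * PowerSeries.X := by
        rw [hf']; ring
      simp only [M, Matrix.of_apply, Fin.cases_succ, Fin.val_succ, Fin.val_castSucc, this,
        map_sub, PowerSeries.coeff_succ_mul_X, PowerSeries.coeff_C_mul, ← add_assoc]
      ring
    have hrow := M.det_updateRow_sum 0 (fun i => A.coeff i)
    simp only [Fin.val_zero, hA0, one_smul] at hrow
    have hvan : ∀ j : Fin m, (∑ k : Fin (m + 1), A.coeff k • M k) j.succ = 0 := by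
      intro j
      simp only [Finset.sum_apply, Pi.smul_apply, smul_eq_mul, M, Matrix.of_apply,
        Fin.cases_succ]
      rw [hsum, hA, mul_comm, h', hE _ (by omega)]
    rw [hcol, ← hrow, Matrix.det_succ_row_zero, Fin.sum_univ_succ]
    simp only [Matrix.updateRow_self, hvan, mul_zero, zero_mul, Finset.sum_const_zero, add_zero]
    have h0 : PowerSeries.coeff n ((A : R⟦X⟧) * f) =
        ∑ k ∈ Finset.range (n + 1), PowerSeries.coeff k E * x 0 ^ (n - k) := by
      refine coeff_eq_sum_of_mul_one_sub_eq ?_ n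
      rw [hA, ← h]; ring
    rw [← h0, ← hsum]
    simp only [Fin.val_zero, pow_zero, one_mul, Finset.sum_apply,
      Pi.smul_apply, smul_eq_mul]
    congr 2
    ext i j
    simp only [Matrix.submatrix_apply, Fin.zero_succAbove, Matrix.of_apply,
      Matrix.updateRow_ne (Fin.succ_ne_zero i), M, Fin.cases_succ, Fin.val_succ, pow_succ',
      mul_assoc]
    rw [mul_comm PowerSeries.X, PowerSeries.coeff_succ_mul_X]

theorem mk_hsymm_eq_prod (σ R : Type*) [Fintype σ] [DecidableEq σ] [CommRing R] :
    PowerSeries.mk (hsymm σ R)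
      = ∏ i : σ, PowerSeries.mk (fun k => (X i : MvPolynomial σ R) ^ k) := by
  ext1 d
  rw [PowerSeries.coeff_mk, PowerSeries.coeff_prod, hsymm]
  refine Finset.sum_bij' (fun s _ => Multiset.toFinsupp (s : Multiset σ))
    (fun l hl => ⟨Finsupp.toMultiset l, ?_⟩) ?_ ?_ ?_ ?_ ?_
  · rw [Finset.mem_finsuppAntidiag] at hl
    rw [Finsupp.card_toMultiset, Finsupp.sum_fintype _ _ (by simp)]
    exact hl.1
  · intro s _
    rw [Finset.mem_finsuppAntidiag]
    refine ⟨?_, Finset.subset_univ _⟩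
    change ∑ i, (s : Multiset σ).count i = d
    rw [Multiset.sum_count_eq_card fun i _ => Finset.mem_univ i]
    exact s.2
  · intro l _
    exact Finset.mem_univ _
  · intro s _
    apply Subtype.ext
    simp
  · intro l hl
    simp
  · intro s _
    simp only [PowerSeries.coeff_mk, Multiset.toFinsupp_apply]
    rw [Finset.prod_multiset_map_count]
    refine Finset.prod_subset (Finset.subset_univ _) fun i _ hi => ?_
    rw [Multiset.count_eq_zero_of_notMem (by simpa using hi), pow_zero]

theorem mk_hsymm_mul_prod (σ R : Type*) [Fintype σ] [DecidableEq σ] [CommRing R] :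
    PowerSeries.mk (hsymm σ R)
      * ∏ i : σ, (1 - PowerSeries.C (X i : MvPolynomial σ R) * PowerSeries.X) = 1 := by
  rw [mk_hsymm_eq_prod, ← Finset.prod_mul_distrib]
  refine Finset.prod_eq_one fun i _ => ?_
  ext1 k
  rw [mul_sub, mul_one, ← mul_assoc, map_sub]
  cases k with
  | zero => simp
  | succ k =>
    rw [PowerSeries.coeff_succ_mul_X, PowerSeries.coeff_mul_C]
    simp [PowerSeries.coeff_one, pow_succ]

/-- The series `∑ (-1)ʲ eⱼ(B) tʲ` with coefficients viewed in `ℂ[x₁,…,x_m]`. -/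
noncomputable def esymmSeries (m : ℕ) (B : Multiset ℂ) : PowerSeries (MvPolynomial (Fin m) ℂ) :=
  PowerSeries.mk fun j => C ((-1 : ℂ) ^ j * B.esymm j)

theorem coeff_esymmSeries_of_card_lt (m : ℕ) (B : Multiset ℂ) {k : ℕ} (hk : B.card < k) :
    PowerSeries.coeff k (esymmSeries m B) = 0 := by
  simp [esymmSeries, Multiset.esymm, Multiset.powersetCard_eq_empty k hk]

theorem sum_coeff_esymmSeries (m : ℕ) (B : Finset ℂ) (p : MvPolynomial (Fin m) ℂ) :
    ∑ k ∈ Finset.range (B.card + 1), PowerSeries.coeff k (esymmSeries m B.val) * p ^ (B.card - k)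
      = ∏ r ∈ B, (p - C r) := by
  have h := congrArg (Polynomial.aeval p) (Multiset.prod_X_sub_X_eq_sum_esymm B.val)
  rw [Finset.card_def, Finset.prod]
  simp only [map_multiset_prod, Multiset.map_map, Function.comp_def, map_sub, map_sum, map_mul,
    map_pow, map_neg, map_one, Polynomial.aeval_X, Polynomial.aeval_C, algebraMap_eq] at h
  rw [h]
  refine Finset.sum_congr rfl fun k _ => ?_
  simp [esymmSeries, mul_assoc]

theorem hXBZ_eq_coeff (m n i j : ℕ) (B : Multiset ℂ) :
    hXBZ m B ((n : ℤ) - (i : ℤ) + (j : ℤ))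
      = PowerSeries.coeff (n + j)
          (PowerSeries.X ^ i * (PowerSeries.mk (hsymm (Fin m) ℂ) * esymmSeries m B)) := by
  rw [PowerSeries.coeff_X_pow_mul', hXBZ]
  by_cases hij : i ≤ n + j
  · have hk : ((n : ℤ) - (i : ℤ) + (j : ℤ)).toNat = n + j - i := by omega
    rw [if_pos (by omega), if_pos hij, hk, mul_comm, PowerSeries.coeff_mul,
      Finset.Nat.sum_antidiagonal_eq_sum_range_succ_mk]
    refine Finset.sum_congr rfl fun k _ => ?_
    rw [esymmSeries, PowerSeries.coeff_mk, PowerSeries.coeff_mk, smul_eq_C_mul]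
  · rw [if_neg (by omega), if_neg hij]

theorem det_hXBZ (m : ℕ) (B : Finset ℂ) :
    (Matrix.of fun i j : Fin m =>
      hXBZ m B.val ((B.card : ℤ) - ((i : ℕ) : ℤ) + ((j : ℕ) : ℤ))).det
      = ∏ i : Fin m, ∏ r ∈ B, (X i - C r) := by
  simp only [hXBZ_eq_coeff, ← sum_coeff_esymmSeries]
  refine det_toeplitz_coeff B.card (fun k hk => coeff_esymmSeries_of_card_lt m B.val hk) m X ?_
  rw [mul_right_comm, mk_hsymm_mul_prod, one_mul]

theorem hMulSubZ_eq_eval (A B : Multiset ℂ) (k : ℤ) :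
    hMulSubZ A B k = eval (fun i : Fin A.card => A.toList.getD i 0) (hXBZ A.card B k) := by
  unfold hMulSubZ hXBZ hMul
  split_ifs <;> simp [smul_eval]

theorem det_hMulSubZ (A B : Finset ℂ) :
    (Matrix.of fun i j : Fin A.card =>
      hMulSubZ A.val B.val ((B.card : ℤ) - ((i : ℕ) : ℤ) + ((j : ℕ) : ℤ))).det
      = ∏ s ∈ A, ∏ r ∈ B, (s - r) := by
  have h := congrArg (eval fun i : Fin A.card => A.val.toList.getD i 0) (det_hXBZ A.card B)
  rw [RingHom.map_det] at h
  simp only [map_prod, map_sub, eval_X, eval_C] at h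
  have hprod : ∀ g : ℂ → ℂ, ∏ i : Fin A.card, g (A.val.toList.getD i 0) = ∏ s ∈ A, g s := by
    intro g
    have hl : A.val.toList.length = A.card := Multiset.length_toList _
    rw [← Finset.prod_map_toList A g, Finset.toList, ← Fin.prod_univ_fun_getElem]
    refine Fintype.prod_equiv (finCongr hl.symm) _ _ fun i => ?_
    rw [List.getD_eq_getElem _ _ (by rw [hl]; exact i.2)]
    rfl
  rw [hprod fun s => ∏ r ∈ B, (s - r)] at h
  rw [← h]
  congr 1
  ext i j
  exact hMulSubZ_eq_eval _ _ _

/-- For disjoint finite sets `Ω₁`, `Ω₂` of complex numbers with `|Ω₁| = m`, `|Ω₂| = n`: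
(a) `S_{λ_{m,n}}(X−Ω₂) · ∏_{s∈Ω₁}∏_{r∈Ω₂}(s−r) = S_{λ_{m,n}}(Ω₁−Ω₂) · ∏ᵢ∏_{r∈Ω₂}(xᵢ−r)`
in `ℂ[x₁,…,x_m]`, where `S_{λ_{m,n}} = det(h_{n−i+j})_{1≤i,j≤m}`; and
(b) `S_{λ_{m,n}}(Ω₁−Ω₂) = det(h_{n−i+j}(Ω₁−Ω₂))_{1≤i,j≤m} ≠ 0`. -/
theorem schur_value_nonvanish (m n : ℕ) (Ω₁ Ω₂ : Finset ℂ) (hd : Disjoint Ω₁ Ω₂)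
    (h1 : Ω₁.card = m) (h2 : Ω₂.card = n) :
    ((Matrix.of fun i j : Fin m =>
          hXBZ m Ω₂.val ((n : ℤ) - ((i : ℕ) : ℤ) + ((j : ℕ) : ℤ))).det *
        C (∏ s ∈ Ω₁, ∏ r ∈ Ω₂, (s - r))
      = C ((Matrix.of fun i j : Fin m =>
          hMulSubZ Ω₁.val Ω₂.val ((n : ℤ) - ((i : ℕ) : ℤ) + ((j : ℕ) : ℤ))).det) *
        ∏ i : Fin m, ∏ r ∈ Ω₂, (X i - C r)) ∧
    (Matrix.of fun i j : Fin m =>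
        hMulSubZ Ω₁.val Ω₂.val ((n : ℤ) - ((i : ℕ) : ℤ) + ((j : ℕ) : ℤ))).det ≠ 0 := by
  subst h1 h2
  rw [det_hXBZ, det_hMulSubZ]
  refine ⟨mul_comm _ _, ?_⟩
  refine Finset.prod_ne_zero_iff.2 fun s hs => Finset.prod_ne_zero_iff.2 fun r hr => ?_
  exact sub_ne_zero.2 (Finset.disjoint_left.1 hd hs <| · ▸ hr)
end

section
/- Let U and V be finite-dimensional complex vector spaces with dim U = dim V, each equipped with an increasing family of subspaces (F^i U)_{i∈ℤ} and (F^i V)_{i∈ℤ}. Suppose ∇ : U × V → ℂ is a nondegenerate bilinear form which preserves the filtration, i.e., ∇(u, v) = 0 whenever u ∈ F^i U and v ∈ F^j V with i + j ≤ −1. Suppose further that Δ is an element of U ⊗ V lying in the subspace Σ_{i+j≤0} F^i U ⊗ F^j V, such that the bilinear form U* × V* → ℂ sending (φ, ψ) to (φ ⊗ ψ)(Δ) is nondegenerate. Then the linear map F : U → V* defined by F(u)(v) = ∇(u, v) is an isomorphism, and for every i ∈ ℤ it restricts to an isomorphism from F^i U onto F^i(V*) := {f ∈ V* : f vanishes on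 F^{−i−1} V}; in particular dim F^i U = dim V − dim F^{−i−1} V for all i. -/
open TensorProduct

/-- Contraction of `U ⊗ V` in the second factor against a functional on `V`. -/
noncomputable def contractSnd {U V : Type*} [AddCommGroup U] [Module ℂ U]
    [AddCommGroup V] [Module ℂ V] : U ⊗[ℂ] V →ₗ[ℂ] (V →ₗ[ℂ] ℂ) →ₗ[ℂ] U :=
  TensorProduct.lift (LinearMap.mk₂ ℂ
    (fun u v => (LinearMap.applyₗ v : (V →ₗ[ℂ] ℂ) →ₗ[ℂ] ℂ).smulRight u)
    (fun _ _ _ => by ext; simp)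
    (fun _ _ _ => by ext; exact smul_comm _ _ _)
    (fun _ _ _ => by ext; simp [add_smul])
    (fun _ _ _ => by ext; simp [mul_smul]))

section

variable {U V : Type*} [AddCommGroup U] [Module ℂ U] [AddCommGroup V] [Module ℂ V]

@[simp]
theorem contractSnd_tmul (u : U) (v : V) (ψ : V →ₗ[ℂ] ℂ) :
    contractSnd (u ⊗ₜ[ℂ] v) ψ = ψ v • u := by
  simp [contractSnd]

theorem apply_contractSnd (Δ : U ⊗[ℂ] V) (φ : U →ₗ[ℂ] ℂ) (ψ : V →ₗ[ℂ] ℂ) :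
    φ (contractSnd Δ ψ) = TensorProduct.lid ℂ ℂ (TensorProduct.map φ ψ Δ) := by
  induction Δ using TensorProduct.induction_on with
  | zero => simp
  | tmul u v => simp [mul_comm]
  | add x y hx hy => simp [hx, hy]

theorem contractSnd_injective {Δ : U ⊗[ℂ] V}
    (hΔ : ∀ ψ : V →ₗ[ℂ] ℂ,
      (∀ φ : U →ₗ[ℂ] ℂ, TensorProduct.lid ℂ ℂ (TensorProduct.map φ ψ Δ) = 0) → ψ = 0) :
    Function.Injective (contractSnd Δ) := by
  refine (injective_iff_map_eq_zero _).2 fun ψ h => hΔ ψ fun φ => ?_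
  rw [← apply_contractSnd, h, map_zero]

/-- A filtered copairing sends functionals vanishing on `F^{-i-1} V` into `F^i U`. -/
theorem contractSnd_mem {FU : ℤ → Submodule ℂ U} (hFU : Monotone FU)
    {FV : ℤ → Submodule ℂ V} (hFV : Monotone FV) {Δ : U ⊗[ℂ] V}
    (hΔ : Δ ∈ ⨆ (i : ℤ) (j : ℤ) (_ : i + j ≤ 0),
      LinearMap.range (TensorProduct.map (FU i).subtype (FV j).subtype))
    (i : ℤ) {ψ : V →ₗ[ℂ] ℂ} (hψ : ψ ∈ Submodule.dualAnnihilator (FV (-i - 1))) :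
    contractSnd Δ ψ ∈ FU i := by
  suffices h : (⨆ (a : ℤ) (b : ℤ) (_ : a + b ≤ 0),
      LinearMap.range (TensorProduct.map (FU a).subtype (FV b).subtype)) ≤
      (FU i).comap (contractSnd.flip ψ) from h hΔ
  refine iSup_le fun a => iSup_le fun b => iSup_le fun hab => ?_
  rintro _ ⟨t, rfl⟩
  induction t using TensorProduct.induction_on with
  | zero => simp
  | add x y hx hy => rw [map_add]; exact add_mem hx hy
  | tmul u v =>
    simp only [TensorProduct.map_tmul, Submodule.subtype_apply, Submodule.mem_comap,
      LinearMap.flip_apply, contractSnd_tmul]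
    rcases le_or_gt b (-i - 1) with hb | hb
    · rw [(Submodule.mem_dualAnnihilator ψ).1 hψ _ (hFV hb v.2), zero_smul]
      exact zero_mem _
    · exact (FU i).smul_mem _ (hFU (by lia) u.2)

end

/-- Let `U`, `V` be finite-dimensional filtered complex vector spaces of the same dimension.
Given a nondegenerate filtration-preserving pairing `∇ : U ⊗ V → ℂ` and a filtration-preserving
co-pairing `Δ ∈ U ⊗ V` whose dual pairing `U* ⊗ V* → ℂ` is nondegenerate, the map
`F : U → V*`, `F(u)(v) = ∇(u,v)` is an isomorphism identifying `F^i U` with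
`F^i(V*) = {f : f vanishes on F^{−i−1}V}`; in particular
`dim F^i U = dim V − dim F^{−i−1} V`. -/
theorem pairing_copairing_duality (U V : Type*)
    [AddCommGroup U] [Module ℂ U] [FiniteDimensional ℂ U]
    [AddCommGroup V] [Module ℂ V] [FiniteDimensional ℂ V]
    (hdim : Module.finrank ℂ U = Module.finrank ℂ V)
    (FU : ℤ → Submodule ℂ U) (hFU : Monotone FU)
    (FV : ℤ → Submodule ℂ V) (hFV : Monotone FV)
    (pair : U →ₗ[ℂ] V →ₗ[ℂ] ℂ)
    (pair_nondeg_left : ∀ u : U, (∀ v : V, pair u v = 0) → u = 0)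
    (pair_nondeg_right : ∀ v : V, (∀ u : U, pair u v = 0) → v = 0)
    (pair_filt : ∀ i j : ℤ, i + j ≤ -1 → ∀ u ∈ FU i, ∀ v ∈ FV j, pair u v = 0)
    (Δ : U ⊗[ℂ] V)
    (hΔ_filt : Δ ∈ ⨆ (i : ℤ) (j : ℤ) (_ : i + j ≤ 0),
        LinearMap.range (TensorProduct.map (FU i).subtype (FV j).subtype))
    (hΔ_nondeg_left : ∀ φ : U →ₗ[ℂ] ℂ,
        (∀ ψ : V →ₗ[ℂ] ℂ, TensorProduct.lid ℂ ℂ (TensorProduct.map φ ψ Δ) = 0) → φ = 0)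
    (hΔ_nondeg_right : ∀ ψ : V →ₗ[ℂ] ℂ,
        (∀ φ : U →ₗ[ℂ] ℂ, TensorProduct.lid ℂ ℂ (TensorProduct.map φ ψ Δ) = 0) → ψ = 0) :
    Function.Bijective pair ∧
    (∀ i : ℤ, Submodule.map pair (FU i) = Submodule.dualAnnihilator (FV (-i - 1))) ∧
    (∀ i : ℤ, Module.finrank ℂ (FU i)
        = Module.finrank ℂ V - Module.finrank ℂ (FV (-i - 1))) := by
  have hinj : Function.Injective pair :=
    (injective_iff_map_eq_zero pair).2 fun u hu => pair_nondeg_left u fun v => by simp [hu]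
  have hdual : Module.finrank ℂ U = Module.finrank ℂ (V →ₗ[ℂ] ℂ) :=
    hdim.trans Subspace.dual_finrank_eq.symm
  have hmap : ∀ i : ℤ, Submodule.map pair (FU i) = Submodule.dualAnnihilator (FV (-i - 1)) := by
    intro i
    refine Submodule.eq_of_le_of_finrank_le ?_ ?_
    · rintro _ ⟨u, hu, rfl⟩
      exact (Submodule.mem_dualAnnihilator _).2 fun v hv =>
        pair_filt i (-i - 1) (by lia) u hu v hv
    · rw [← (Submodule.equivMapOfInjective pair hinj (FU i)).finrank_eq]
      exact LinearMap.finrank_le_finrank_of_injective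
        (f := (contractSnd Δ).restrict fun _ => contractSnd_mem hFU hFV hΔ_filt i)
        fun x y h => Subtype.ext
          (contractSnd_injective hΔ_nondeg_right (congrArg Subtype.val h))
  refine ⟨⟨hinj, (LinearMap.injective_iff_surjective_of_finrank_eq_finrank hdual).1 hinj⟩,
    hmap, fun i => ?_⟩
  have h := Subspace.finrank_add_finrank_dualAnnihilator_eq (FV (-i - 1))
  rw [← hmap i, ← (Submodule.equivMapOfInjective pair hinj (FU i)).finrank_eq] at h
  lia
end
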